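/- For every integer m ≥ 1, there are exactly two integers n with 6 ≤ n < 6 + 2^m such that the function j ↦ ν₂(S(j,6)) is non-constant on [n]_{2^m}; moreover, for every m ≥ 1, whenever j ↦ ν₂(S(j,6)) is non-constant on a class [n]_{2^m}, it is non-constant on exactly one of the two children [n]_{2^(m+1)} and [n + 2^m]_{2^(m+1)}. In particular, N_{6,1} = {6,7}, N_{6,2} = {8,9}, and N_{6,3} = {12,13}. -/

import Mathlib

/-- Stirling numbers of the second kind, via the standard recurrence. -/
def stirling2 : ℕ → ℕ → ℕ
  | 0, 0 => 1
  | 0, _ + 1 => 0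
  | _ + 1, 0 => 0
  | n + 1, k + 1 => (k + 1) * stirling2 n (k + 1) + stirling2 n k

/-- The congruence class `[n]_t = { j : j ≥ max(n,t) and j ≡ n (mod t) }`. -/
def cls (n t : ℕ) : Set ℕ := {j | max n t ≤ j ∧ j ≡ n [MOD t]}

/-- `b_k = ⌈log₂ k⌉ - 2`. -/
def bk (k : ℕ) : ℕ := Nat.clog 2 k - 2

/-- A set of naturals is constant modulo `M`. -/
def ConstMod (M : ℕ) (A : Set ℕ) : Prop := ∀ a ∈ A, ∀ b ∈ A, a ≡ b [MOD M]

/-- The image set `S([n]_{2^m}, k)`. -/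
def Scls (k n m : ℕ) : Set ℕ := (fun j => stirling2 j k) '' cls n (2 ^ m)

/-- The function `j ↦ ν₂(S(j,k))` is constant on the set `A`. -/
def ValConstOn (k : ℕ) (A : Set ℕ) : Prop :=
  ∀ i ∈ A, ∀ j ∈ A, padicValNat 2 (stirling2 i k) = padicValNat 2 (stirling2 j k)

/-- `N_{k,m}`: the set of `n` with `k ≤ n < k + 2^m` on which `ν₂ ∘ S(·,k)`
is non-constant on `[n]_{2^m}`. -/
def Nkm (k m : ℕ) : Set ℕ :=
  {n | k ≤ n ∧ n < k + 2 ^ m ∧ ¬ ValConstOn k (cls n (2 ^ m))}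

/-- The explicit formula for `S(n,6)`, cleared of denominators. -/
theorem stirling2_six_formula (n : ℕ) (hn : 1 ≤ n) :
    720 * (stirling2 n 6 : ℤ) =
      6 ^ n - 6 * 5 ^ n + 15 * 4 ^ n - 20 * 3 ^ n + 15 * 2 ^ n - 6 := by
  have key : ∀ n : ℕ, stirling2 (n + 1) 0 = 0 ∧ (stirling2 (n + 1) 1 : ℤ) = 1 ∧
      2 * (stirling2 (n + 1) 2 : ℤ) = 2 * 2 ^ n - 2 ∧
      6 * (stirling2 (n + 1) 3 : ℤ) = 3 * 3 ^ n - 6 * 2 ^ n + 3 ∧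
      24 * (stirling2 (n + 1) 4 : ℤ) = 4 * 4 ^ n - 12 * 3 ^ n + 12 * 2 ^ n - 4 ∧
      120 * (stirling2 (n + 1) 5 : ℤ) =
        5 * 5 ^ n - 20 * 4 ^ n + 30 * 3 ^ n - 20 * 2 ^ n + 5 ∧
      720 * (stirling2 (n + 1) 6 : ℤ) =
        6 * 6 ^ n - 30 * 5 ^ n + 60 * 4 ^ n - 60 * 3 ^ n + 30 * 2 ^ n - 6 := by
    intro n
    induction n with
    | zero => simp [stirling2]
    | succ n ih =>
      obtain ⟨h0, h1, h2, h3, h4, h5, h6⟩ := ih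
      have hrec : ∀ k, (stirling2 (n + 1 + 1) (k + 1) : ℤ) =
          (k + 1) * stirling2 (n + 1) (k + 1) + stirling2 (n + 1) k := fun k => by
        rw [stirling2]; push_cast; rfl
      have r0 := hrec 0
      have r1 := hrec 1
      have r2 := hrec 2
      have r3 := hrec 3
      have r4 := hrec 4
      have r5 := hrec 5
      push_cast [h0] at r0 r1 r2 r3 r4 r5
      norm_num at r0 r1 r2 r3 r4 r5
      refine ⟨rfl, ?_, ?_, ?_, ?_, ?_, ?_⟩ <;> (try simp only [pow_succ]) <;> linarith
  obtain ⟨n, rfl⟩ : ∃ m, n = m + 1 := ⟨n - 1, by omega⟩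
  rw [(key n).2.2.2.2.2.2]
  ring

theorem stirling2_self_add_pos (k d : ℕ) (hk : 1 ≤ k) : 0 < stirling2 (k + d) k := by
  obtain ⟨k, rfl⟩ : ∃ m, k = m + 1 := ⟨k - 1, by omega⟩
  induction d with
  | zero =>
    clear hk
    induction k with
    | zero => decide
    | succ k ih => rw [stirling2]; exact Nat.add_pos_right _ ih
  | succ d ih =>
    rw [← add_assoc, stirling2]
    exact Nat.add_pos_left (Nat.mul_pos k.succ_pos ih) _

theorem stirling2_ne_zero {k n : ℕ} (hk : 1 ≤ k) (hn : k ≤ n) : stirling2 n k ≠ 0 := by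
  obtain ⟨d, rfl⟩ := Nat.exists_eq_add_of_le hn
  exact (stirling2_self_add_pos k d hk).ne'

theorem five_pow_two_pow (k : ℕ) :
    ∃ u : ℤ, (5 : ℤ) ^ 2 ^ (k + 1) = 1 + 8 * 2 ^ k * (2 * u + 1) := by
  induction k with
  | zero => exact ⟨1, by norm_num⟩
  | succ k ih =>
    obtain ⟨u, hu⟩ := ih
    refine ⟨u + 2 * 2 ^ k * (2 * u + 1) ^ 2, ?_⟩
    rw [pow_succ 2 (k + 1), pow_mul, hu]
    ring

theorem three_pow_two_pow (k : ℕ) :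
    ∃ v : ℤ, (3 : ℤ) ^ 2 ^ (k + 1) = 1 + 8 * 2 ^ k * v := by
  induction k with
  | zero => exact ⟨1, by norm_num⟩
  | succ k ih =>
    obtain ⟨v, hv⟩ := ih
    refine ⟨v + 4 * 2 ^ k * v ^ 2, ?_⟩
    rw [pow_succ 2 (k + 1), pow_mul, hv]
    ring

/-- Shifting the argument of `S(·,6)` by `2 ^ (k + 1)` changes the value by an odd multiple of
`2 ^ k`. -/
theorem stirling2_six_add_two_pow (k j : ℕ) (hj : 6 ≤ j) (hkj : 2 ^ (k + 1) ≤ j) :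
    ∃ e : ℤ, (stirling2 (j + 2 ^ (k + 1)) 6 : ℤ) = stirling2 j 6 + 2 ^ k * (2 * e + 1) := by
  have hjk : k + 4 ≤ j := by
    rcases Nat.lt_or_ge k 3 with h | h
    · omega
    · refine le_trans ?_ hkj
      clear hkj
      induction k, h using Nat.le_induction with
      | base => norm_num
      | succ k _ ih => rw [pow_succ]; omega
  obtain ⟨i, rfl⟩ := Nat.exists_eq_add_of_le hjk
  obtain ⟨u, hu⟩ := five_pow_two_pow k
  obtain ⟨v, hv⟩ := three_pow_two_pow k
  have h0 := stirling2_six_formula (k + 4 + i) (by omega)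
  have h1 := stirling2_six_formula (k + 4 + i + 2 ^ (k + 1)) (le_add_right (by omega))
  set t := 2 ^ (k + 1) with ht
  set j := k + 4 + i with hjdef
  have hbracket : Even ((3 : ℤ) ^ j * (6 ^ t - 1) + 15 * 2 ^ j * (4 ^ t - 1)
      + 15 * (2 ^ t - 1)) := by
    have ht0 : t ≠ 0 := by positivity
    have hj0 : j ≠ 0 := by omega
    have e6 : Even ((6 : ℤ) ^ t) := Even.pow_of_ne_zero (by decide) ht0
    have e2 : Even ((2 : ℤ) ^ t) := Even.pow_of_ne_zero (by decide) ht0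
    have e2j : Even ((2 : ℤ) ^ j) := Even.pow_of_ne_zero (by decide) hj0
    have o3 : Odd ((3 : ℤ) ^ j) := Odd.pow (by decide)
    have o15 : Odd (15 : ℤ) := by decide
    exact ((o3.mul (e6.sub_odd odd_one)).add_even ((e2j.mul_left 15).mul_right _)).add_odd
      (o15.mul (e2.sub_odd odd_one))
  obtain ⟨b, hb⟩ := hbracket
  obtain ⟨c, hc⟩ : Odd ((5 : ℤ) ^ j) := Odd.pow (by decide)
  have h2j : (2 : ℤ) ^ j = 16 * 2 ^ k * 2 ^ i := by rw [hjdef]; ring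
  have h6 : (6 : ℤ) ^ j = 2 ^ j * 3 ^ j := by rw [← mul_pow]; norm_num
  have h4 : (4 : ℤ) ^ j = 2 ^ j * 2 ^ j := by rw [← mul_pow]; norm_num
  set D : ℤ := stirling2 (j + t) 6 - stirling2 j 6 with hD
  clear_value D
  have hs : (0 : ℤ) < 2 ^ k := by positivity
  have hmain : 45 * D = 2 ^ k * (2 * (2 ^ i * b - 5 * 3 ^ j * v
      - 3 * (2 * c * u + c + u) - 2) + 1) := by
    have h720 : 720 * D = 2 ^ j * (b + b)
        - 6 * 5 ^ j * (5 ^ t - 1) - 20 * 3 ^ j * (3 ^ t - 1) := by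
      rw [← hb, hD, mul_sub, h1, h0]
      simp only [pow_add, h6, h4]
      ring
    rw [hu, hv, hc, h2j] at h720
    refine mul_left_cancel₀ (by norm_num : (16 : ℤ) ≠ 0) ?_
    linear_combination h720
  have hdvd : (2 : ℤ) ^ k ∣ D := by
    have hcop : IsCoprime ((2 : ℤ) ^ k) 45 := IsCoprime.pow_left ⟨-22, 1, by norm_num⟩
    exact hcop.dvd_of_dvd_mul_left ⟨_, hmain⟩
  obtain ⟨E, hE⟩ := hdvd
  have hE' : 45 * E = 2 * (2 ^ i * b - 5 * 3 ^ j * v - 3 * (2 * c * u + c + u) - 2) + 1 := by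
    refine mul_left_cancel₀ hs.ne' ?_
    rw [← hmain, hE]
    ring
  refine ⟨E / 2, ?_⟩
  have hodd : 2 * (E / 2) + 1 = E := by omega
  rw [hodd, ← hE, hD]
  ring

theorem padicValNat_eq_of_modEq {p k a b : ℕ} [Fact p.Prime] (h : a ≡ b [MOD p ^ k])
    (ha : ¬ p ^ k ∣ a) : padicValNat p a = padicValNat p b := by
  have hb : ¬ p ^ k ∣ b := fun hb => ha ((h.dvd_iff dvd_rfl).2 hb)
  have ha0 : a ≠ 0 := fun h0 => ha (h0 ▸ dvd_zero _)
  have hb0 : b ≠ 0 := fun h0 => hb (h0 ▸ dvd_zero _)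
  have hak : padicValNat p a < k := by
    by_contra! hk
    exact ha ((padicValNat_dvd_iff_le ha0).2 hk)
  have hbk : padicValNat p b < k := by
    by_contra! hk
    exact hb ((padicValNat_dvd_iff_le hb0).2 hk)
  apply le_antisymm
  · exact (padicValNat_dvd_iff_le hb0).1
      ((h.dvd_iff (pow_dvd_pow p hak.le)).1 pow_padicValNat_dvd)
  · exact (padicValNat_dvd_iff_le ha0).1
      ((h.dvd_iff (pow_dvd_pow p hbk.le)).2 pow_padicValNat_dvd)

theorem stirling2_six_modEq_add (k j q : ℕ) (hj : 6 ≤ j) (hkj : 2 ^ (k + 1) ≤ j) :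
    stirling2 (j + 2 ^ (k + 1) * q) 6 ≡ stirling2 j 6 [MOD 2 ^ k] := by
  induction q with
  | zero => rfl
  | succ q ih =>
    refine Nat.ModEq.trans ?_ ih
    obtain ⟨e, he⟩ := stirling2_six_add_two_pow k (j + 2 ^ (k + 1) * q) (by omega) (by omega)
    rw [mul_add, mul_one, ← add_assoc]
    refine Nat.ModEq.symm (Nat.modEq_iff_dvd.2 ⟨2 * e + 1, ?_⟩)
    push_cast
    rw [he]
    ring

theorem add_mul_succ_mem_cls (n t q : ℕ) : n + t * (q + 1) ∈ cls n t :=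
  ⟨max_le (Nat.le_add_right _ _) (le_add_left (Nat.le_mul_of_pos_right t q.succ_pos)),
    by simp [Nat.ModEq]⟩

theorem stirling2_six_modEq_of_mem_cls {k n i j : ℕ} (hn : 6 ≤ n)
    (hi : i ∈ cls n (2 ^ (k + 1))) (hj : j ∈ cls n (2 ^ (k + 1))) :
    stirling2 i 6 ≡ stirling2 j 6 [MOD 2 ^ k] := by
  wlog hij : j ≤ i generalizing i j
  · exact (this hj hi (le_of_not_ge hij)).symm
  obtain ⟨q, hq⟩ := (Nat.modEq_iff_dvd' hij).1 (hj.2.trans hi.2.symm)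
  obtain rfl : i = j + 2 ^ (k + 1) * q := by omega
  have h := max_le_iff.1 hj.1
  exact stirling2_six_modEq_add k j q (hn.trans h.1) h.2

/-- If `2 ^ k` divides `S(j,6)`, then of `S(j,6)` and `S(j + 2 ^ (k + 1),6)`
exactly one is divisible by `2 ^ (k + 1)`. -/
theorem two_pow_succ_dvd_stirling2_six_add_iff {k j : ℕ} (hj : 6 ≤ j) (hkj : 2 ^ (k + 1) ≤ j)
    (h : 2 ^ k ∣ stirling2 j 6) :
    2 ^ (k + 1) ∣ stirling2 (j + 2 ^ (k + 1)) 6 ↔ ¬ 2 ^ (k + 1) ∣ stirling2 j 6 := by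
  obtain ⟨e, he⟩ := stirling2_six_add_two_pow k j hj hkj
  obtain ⟨x, hx⟩ := h
  have hs : (2 : ℤ) ^ k ≠ 0 := by positivity
  rw [← Int.natCast_dvd_natCast, ← Int.natCast_dvd_natCast, he, hx]
  push_cast
  rw [← mul_add, pow_succ, mul_dvd_mul_iff_left hs, mul_dvd_mul_iff_left hs]
  omega

theorem not_valConstOn_six_iff {n : ℕ} (k : ℕ) (hn : 6 ≤ n) :
    ¬ ValConstOn 6 (cls n (2 ^ (k + 1))) ↔ 2 ^ k ∣ stirling2 (n + 2 ^ (k + 1)) 6 := by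
  have hmem : n + 2 ^ (k + 1) ∈ cls n (2 ^ (k + 1)) := by
    simpa using add_mul_succ_mem_cls n (2 ^ (k + 1)) 0
  have hmem' : n + 2 ^ (k + 1) + 2 ^ (k + 1) ∈ cls n (2 ^ (k + 1)) := by
    convert add_mul_succ_mem_cls n (2 ^ (k + 1)) 1 using 1
    ring
  constructor
  · contrapose
    intro h
    have hval : ∀ i ∈ cls n (2 ^ (k + 1)), padicValNat 2 (stirling2 (n + 2 ^ (k + 1)) 6) =
        padicValNat 2 (stirling2 i 6) := fun i hi =>
      padicValNat_eq_of_modEq (stirling2_six_modEq_of_mem_cls hn hmem hi) h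
    exact fun i hi j hj => (hval i hi).symm.trans (hval j hj)
  · intro h hconst
    have hiff := two_pow_succ_dvd_stirling2_six_add_iff (by omega) (by omega) h
    have hval := hconst _ hmem _ hmem'
    rw [padicValNat_dvd_iff_le (stirling2_ne_zero (by norm_num) (by omega)),
      padicValNat_dvd_iff_le (stirling2_ne_zero (by norm_num) (by omega)), hval] at hiff
    exact iff_not_self hiff

theorem two_pow_dvd_stirling2_six_iff_of_mem_cls {k n j : ℕ} (hn : 6 ≤ n)
    (hj : j ∈ cls n (2 ^ (k + 1))) :
    2 ^ k ∣ stirling2 j 6 ↔ ¬ ValConstOn 6 (cls n (2 ^ (k + 1))) := by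
  rw [not_valConstOn_six_iff k hn]
  refine (stirling2_six_modEq_of_mem_cls hn hj ?_).dvd_iff dvd_rfl
  simpa using add_mul_succ_mem_cls n (2 ^ (k + 1)) 0

/-- A non-constant class has exactly one non-constant child, and a class with a non-constant child
is itself non-constant. -/
theorem not_valConstOn_six_children {n : ℕ} (k : ℕ) (hn : 6 ≤ n) :
    (¬ ValConstOn 6 (cls n (2 ^ (k + 1))) →
      Xor (¬ ValConstOn 6 (cls n (2 ^ (k + 2))))
        (¬ ValConstOn 6 (cls (n + 2 ^ (k + 1)) (2 ^ (k + 2))))) ∧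
    (¬ ValConstOn 6 (cls n (2 ^ (k + 2))) → ¬ ValConstOn 6 (cls n (2 ^ (k + 1)))) ∧
    (¬ ValConstOn 6 (cls (n + 2 ^ (k + 1)) (2 ^ (k + 2))) →
      ¬ ValConstOn 6 (cls n (2 ^ (k + 1)))) := by
  have hj : n + 2 ^ (k + 2) ∈ cls n (2 ^ (k + 1)) := by
    convert add_mul_succ_mem_cls n (2 ^ (k + 1)) 1 using 1
    ring
  have hj' : n + 2 ^ (k + 2) + 2 ^ (k + 1) ∈ cls n (2 ^ (k + 1)) := by
    convert add_mul_succ_mem_cls n (2 ^ (k + 1)) 2 using 1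
    ring
  have hc : n + 2 ^ (k + 2) ∈ cls n (2 ^ (k + 2)) := by
    simpa using add_mul_succ_mem_cls n (2 ^ (k + 2)) 0
  have hc' : n + 2 ^ (k + 2) + 2 ^ (k + 1) ∈ cls (n + 2 ^ (k + 1)) (2 ^ (k + 2)) := by
    convert add_mul_succ_mem_cls (n + 2 ^ (k + 1)) (2 ^ (k + 2)) 0 using 1
    ring
  have iff_parent := two_pow_dvd_stirling2_six_iff_of_mem_cls hn hj
  have iff_parent' := two_pow_dvd_stirling2_six_iff_of_mem_cls hn hj'
  rw [← two_pow_dvd_stirling2_six_iff_of_mem_cls hn hc,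
    ← two_pow_dvd_stirling2_six_iff_of_mem_cls (hn.trans (Nat.le_add_right _ _)) hc']
  have hpow : 2 ^ k ∣ 2 ^ (k + 1) := pow_dvd_pow 2 k.le_succ
  refine ⟨fun h => ?_, fun h => iff_parent.1 (hpow.trans h), fun h => iff_parent'.1 (hpow.trans h)⟩
  have hle : 2 ^ (k + 1) ≤ n + 2 ^ (k + 2) :=
    le_add_left (Nat.pow_le_pow_right two_pos (k + 1).le_succ)
  have := two_pow_succ_dvd_stirling2_six_add_iff (le_add_right hn) hle (iff_parent.2 h)
  rw [this]
  exact xor_not_right.2 Iff.rfl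

theorem Nkm_six_eq_filter (k : ℕ) :
    Nkm 6 (k + 1) = ((Finset.Ico 6 (6 + 2 ^ (k + 1))).filter
      fun n => 2 ^ k ∣ stirling2 (n + 2 ^ (k + 1)) 6 : Finset ℕ) := by
  ext n
  simp only [Nkm, Set.mem_ofPred_eq, Finset.coe_filter, Finset.mem_Ico, and_assoc]
  exact and_congr_right fun hn => and_congr_right fun _ => not_valConstOn_six_iff k hn

theorem ncard_Nkm_six (k : ℕ) : (Nkm 6 (k + 1)).ncard = 2 := by
  induction k with
  | zero => rw [Nkm_six_eq_filter, Set.ncard_coe_finset]; simp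
  | succ k ih =>
    rw [← ih]
    have hdouble : 2 ^ (k + 1 + 1) = 2 ^ (k + 1) + 2 ^ (k + 1) := by ring
    symm
    classical
    refine Set.ncard_congr (fun n _ => if ValConstOn 6 (cls n (2 ^ (k + 2)))
      then n + 2 ^ (k + 1) else n) ?_ ?_ ?_
    · rintro n ⟨h6, hlt, hn⟩
      have := (not_valConstOn_six_children k h6).1 hn
      split_ifs with h
      · exact ⟨by omega, by omega, by simpa [Xor, h] using this⟩
      · exact ⟨by omega, by omega, h⟩
    · rintro a b ⟨ha6, halt, -⟩ ⟨hb6, hblt, -⟩ hab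
      split_ifs at hab <;> omega
    · rintro b ⟨h6, hlt, hb⟩
      rcases Nat.lt_or_ge b (6 + 2 ^ (k + 1)) with h | h
      · exact ⟨b, ⟨h6, h, (not_valConstOn_six_children k h6).2.1 hb⟩, if_neg hb⟩
      · obtain ⟨a, rfl⟩ : ∃ a, b = a + 2 ^ (k + 1) := ⟨b - 2 ^ (k + 1), by omega⟩
        have ha6 : 6 ≤ a := by omega
        have hpar := (not_valConstOn_six_children k ha6).2.2 hb
        have hx := (not_valConstOn_six_children k ha6).1 hpar
        refine ⟨a, ⟨ha6, by omega, hpar⟩, if_pos ?_⟩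
        by_contra hcon
        exact hx.elim (fun h => h.2 hb) (fun h => h.2 hcon)

theorem AMM_k6 :
    (∀ m, 1 ≤ m → (Nkm 6 m).ncard = 2) ∧
    (∀ m, 1 ≤ m → ∀ n, 6 ≤ n → ¬ ValConstOn 6 (cls n (2 ^ m)) →
      Xor' (¬ ValConstOn 6 (cls n (2 ^ (m + 1))))
        (¬ ValConstOn 6 (cls (n + 2 ^ m) (2 ^ (m + 1))))) ∧
    Nkm 6 1 = {6, 7} ∧ Nkm 6 2 = {8, 9} ∧ Nkm 6 3 = {12, 13} := by
  refine ⟨fun m hm => ?_, fun m hm n hn h => ?_, ?_, ?_, ?_⟩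
  · obtain ⟨k, rfl⟩ := Nat.exists_eq_add_of_le' hm
    exact ncard_Nkm_six k
  · obtain ⟨k, rfl⟩ := Nat.exists_eq_add_of_le' hm
    exact (not_valConstOn_six_children k hn).1 h
  · rw [Nkm_six_eq_filter 0, ← Finset.coe_pair, Finset.coe_inj]
    decide
  · rw [Nkm_six_eq_filter 1, ← Finset.coe_pair, Finset.coe_inj]
    decide
  · rw [Nkm_six_eq_filter 2, ← Finset.coe_pair, Finset.coe_inj]
    decide
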